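/- arXiv:1401.4348 — 10 statements merged into one kernel-verified Lean document; each statement's English description precedes it below -/
import Mathlib

section
/- Let q be an odd prime power. Then I(2,q) = q: every integral point set in F_q^2 has cardinality at most q, and there exists an integral point set in F_q^2 of cardinality exactly q. -/
open Finset

theorem exists_sq_add_sq_eq {F : Type*} [Field F] [Fintype F] (hF : Odd (Fintype.card F))
    (x : F) : ∃ a b : F, a ^ 2 + b ^ 2 = x := by
  obtain ⟨a, b, hab⟩ := FiniteField.exists_root_sum_quadratic (R := F)
    (Polynomial.degree_X_pow 2) (Polynomial.degree_X_pow_sub_C (n := 2) two_pos x)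
    (Nat.odd_iff.mp hF)
  refine ⟨a, b, ?_⟩
  simp only [Polynomial.eval_pow, Polynomial.eval_sub, Polynomial.eval_X, Polynomial.eval_C] at hab
  linear_combination hab

/-- A projection along a direction of nonsquare norm is injective on an integral point set. -/
theorem card_le_of_not_isSquare_sq_add_sq {F : Type*} [Field F] [Fintype F] {a b : F}
    (hab : ¬ IsSquare (a ^ 2 + b ^ 2)) (P : Finset (Fin 2 → F))
    (hP : ∀ u ∈ P, ∀ v ∈ P, IsSquare (∑ i, (u i - v i) ^ 2)) :
    P.card ≤ Fintype.card F := by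
  have hN : a ^ 2 + b ^ 2 ≠ 0 := by
    rintro h
    exact hab (h ▸ IsSquare.zero)
  refine card_le_card_of_injOn (t := univ) (fun u => b * u 0 - a * u 1) (by simp) ?_
  intro u hu v hv huv
  have hφ : b * u 0 - a * u 1 = b * v 0 - a * v 1 := huv
  set t := (a * (u 0 - v 0) + b * (u 1 - v 1)) / (a ^ 2 + b ^ 2) with ht
  have h0 : u 0 - v 0 = t * a := by
    rw [ht]; field_simp; linear_combination b * hφ
  have h1 : u 1 - v 1 = t * b := by
    rw [ht]; field_simp; linear_combination -a * hφ
  have ht0 : t = 0 := by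
    by_contra hne
    obtain ⟨r, hr⟩ := hP u hu v hv
    rw [Fin.sum_univ_two, h0, h1] at hr
    refine hab ⟨r / t, ?_⟩
    field_simp
    linear_combination hr
  funext i
  fin_cases i
  · exact sub_eq_zero.mp (by simpa [ht0] using h0)
  · exact sub_eq_zero.mp (by simpa [ht0] using h1)

/-- For an odd prime power `q`, `I(2,q) = q`: every integral point set
in `F_q²` has cardinality at most `q`, and one of cardinality exactly `q` exists. -/
theorem integral_point_set_dim_two (q : ℕ) (hq : IsPrimePow q) (hodd : Odd q)
    (F : Type) [Field F] [Fintype F] (hcard : Fintype.card F = q) :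
    (∀ P : Finset (Fin 2 → F),
      (∀ u ∈ P, ∀ v ∈ P, IsSquare (∑ i, (u i - v i) ^ 2)) → P.card ≤ q) ∧
    (∃ P : Finset (Fin 2 → F),
      (∀ u ∈ P, ∀ v ∈ P, IsSquare (∑ i, (u i - v i) ^ 2)) ∧ P.card = q) := by
  subst hcard
  constructor
  · have hchar : ringChar F ≠ 2 := fun h => by
      have := FiniteField.even_card_of_char_two h
      have := Nat.odd_iff.mp hodd
      omega
    obtain ⟨n, hn⟩ := FiniteField.exists_nonsquare hchar
    obtain ⟨a, b, rfl⟩ := exists_sq_add_sq_eq hodd n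
    exact card_le_of_not_isSquare_sq_add_sq hn
  · refine ⟨univ.map ⟨fun x : F => ![x, 0], fun x y h => congrFun h 0⟩, ?_, by simp⟩
    intro u hu v hv
    obtain ⟨x, -, rfl⟩ := mem_map.mp hu
    obtain ⟨y, -, rfl⟩ := mem_map.mp hv
    refine ⟨x - y, ?_⟩
    rw [Fin.sum_univ_two]
    change (x - y) ^ 2 + (0 - 0) ^ 2 = (x - y) * (x - y)
    ring
end

section
/- Let q be an odd prime power and u ∈ F_q³ with u₁² + u₂² + u₃² = 1. Then there exist vectors v, w ∈ F_q³ with v₁² + v₂² + v₃² = 1 and w₁² + w₂² + w₃² = 1 such that ⟨u,v⟩ = ⟨u,w⟩ = ⟨v,w⟩ = 0. -/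
open Finset

/-- Over any field, the images of the last two standard basis vectors under the reflection
exchanging `e₀` and `u` complete a unit vector `u` with `u 0 ≠ 1` to an orthonormal basis. -/
theorem exists_orthonormal_of_apply_zero_ne_one {F : Type*} [Field F] (u : Fin 3 → F)
    (hu : ∑ i, u i * u i = 1) (h0 : u 0 ≠ 1) :
    ∃ v w : Fin 3 → F, (∑ i, v i * v i = 1) ∧ (∑ i, w i * w i = 1) ∧
      (∑ i, u i * v i = 0) ∧ (∑ i, u i * w i = 0) ∧ (∑ i, v i * w i = 0) := by
  obtain ⟨s, hs⟩ : ∃ s, (1 - u 0) * s = 1 :=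
    ⟨_, mul_inv_cancel₀ (sub_ne_zero.mpr h0.symm)⟩
  simp only [Fin.sum_univ_three] at hu ⊢
  refine ⟨![u 1, 1 - u 1 * u 1 * s, -(u 1 * u 2 * s)],
    ![u 2, -(u 1 * u 2 * s), 1 - u 2 * u 2 * s], ?_⟩
  simp only [Matrix.cons_val]
  refine ⟨?_, ?_, ?_, ?_, ?_⟩ <;> grind

/-- Any vector of norm `1` in `F_q³` extends to an orthonormal basis. -/
theorem extend_to_orthonormal_basis (q : ℕ) (hq : IsPrimePow q) (hodd : Odd q)
    (F : Type) [Field F] [Fintype F] (hcard : Fintype.card F = q)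
    (u : Fin 3 → F) (hu : ∑ i, u i * u i = 1) :
    ∃ v w : Fin 3 → F, (∑ i, v i * v i = 1) ∧ (∑ i, w i * w i = 1) ∧
      (∑ i, u i * v i = 0) ∧ (∑ i, u i * w i = 0) ∧ (∑ i, v i * w i = 0) := by
  have h2 : (2 : F) ≠ 0 := by
    refine Ring.two_ne_zero fun h => ?_
    have := FiniteField.even_card_of_char_two h
    rw [hcard] at this
    rw [Nat.odd_iff] at hodd
    omega
  by_cases h0 : u 0 = 1
  · have h : (-u) 0 ≠ 1 := by
      rw [Pi.neg_apply, h0]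
      grind
    simpa using exists_orthonormal_of_apply_zero_ne_one (-u) (by simpa using hu) h
  · exact exists_orthonormal_of_apply_zero_ne_one u hu h0
end

section
/- Let q be an odd prime power, m ≥ 4, and u ∈ F_q^m. Then there exists a matrix A ∈ F_q^{m×m} with AᵀA = E such that the m-th coordinate of Au is equal to zero. -/
open Finset Matrix

/-- A nondegenerate diagonal binary quadratic form over a finite field of odd order
represents `1`. -/
theorem FiniteField.exists_mul_sq_add_mul_sq_eq_one {F : Type*} [Field F] [Fintype F]
    (hF : Fintype.card F % 2 = 1) {s t : F} (hs : s ≠ 0) (ht : t ≠ 0) :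
    ∃ x y : F, s * x ^ 2 + t * y ^ 2 = 1 := by
  obtain ⟨x, y, h⟩ := FiniteField.exists_root_sum_quadratic
    (f := Polynomial.C s * Polynomial.X ^ 2 + Polynomial.C 0 * Polynomial.X + Polynomial.C 0)
    (g := Polynomial.C t * Polynomial.X ^ 2 + Polynomial.C 0 * Polynomial.X + Polynomial.C (-1))
    (Polynomial.degree_quadratic hs) (Polynomial.degree_quadratic ht) hF
  refine ⟨x, y, ?_⟩
  simp at h
  linear_combination h

/-- Every vector of length four over a finite field of odd order is orthogonal to a vector
of norm one. -/
theorem FiniteField.exists_unit_orthogonal_four {F : Type*} [Field F] [Fintype F]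
    (hF : Fintype.card F % 2 = 1) (h2 : (2 : F) ≠ 0) (a b c d : F) :
    ∃ x y z w : F, x * x + y * y + z * z + w * w = 1 ∧
      x * a + y * b + z * c + w * d = 0 := by
  by_cases ha : a = 0
  · exact ⟨1, 0, 0, 0, by simp, by simp [ha]⟩
  by_cases hd : d = 0
  · exact ⟨0, 0, 0, 1, by simp, by simp [hd]⟩
  by_cases hs : a ^ 2 + b ^ 2 = 0
  · refine ⟨-c / (2 * a), c * b / (2 * a ^ 2), 1, 0, ?_, ?_⟩
    · field_simp
      linear_combination c ^ 2 * hs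
    · field_simp
      linear_combination c * hs
  by_cases hN : a ^ 2 + b ^ 2 + c ^ 2 + d ^ 2 = 0
  · have hM : a ^ 2 + b ^ 2 + c ^ 2 ≠ 0 := fun h => pow_ne_zero 2 hd (by linear_combination hN - h)
    obtain ⟨x, y, h⟩ := exists_mul_sq_add_mul_sq_eq_one hF hs (mul_ne_zero hs hM)
    exact ⟨x * b + y * (a * c), -x * a + y * (b * c), -y * (a ^ 2 + b ^ 2), 0,
      by linear_combination h, by ring⟩
  · obtain ⟨x, y, h⟩ := exists_mul_sq_add_mul_sq_eq_one hF hN hN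
    exact ⟨-x * b - y * c, x * a + y * d, -x * d + y * a, x * c - y * b,
      by linear_combination h, by ring⟩

/-- Every vector of length at least four over a finite field of odd order is orthogonal to a
vector of norm one. -/
theorem FiniteField.exists_unit_orthogonal {F : Type*} [Field F] [Fintype F]
    (hF : Fintype.card F % 2 = 1) (h2 : (2 : F) ≠ 0) {m : ℕ} (hm : 4 ≤ m) (u : Fin m → F) :
    ∃ r : Fin m → F, r ⬝ᵥ r = 1 ∧ r ⬝ᵥ u = 0 := by
  obtain ⟨k, rfl⟩ := Nat.exists_eq_add_of_le' hm
  obtain ⟨x, y, z, w, h1, h0⟩ := exists_unit_orthogonal_four hF h2 (u 0) (u 1) (u 2) (u 3)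
  refine ⟨vecCons x (vecCons y (vecCons z (vecCons w 0))), ?_, ?_⟩
  · simp only [cons_dotProduct_cons, zero_dotProduct]
    linear_combination h1
  · simp only [cons_dotProduct, zero_dotProduct]
    change x * u 0 + (y * u 1 + (z * u 2 + (w * u 3 + 0))) = 0
    linear_combination h0

/-- The reflection along a non-isotropic vector is orthogonal. -/
theorem Matrix.transpose_mul_self_householder {n F : Type*} [Fintype n] [DecidableEq n] [Field F]
    {v : n → F} (hv : v ⬝ᵥ v ≠ 0) :
    (1 - (2 / (v ⬝ᵥ v)) • vecMulVec v v)ᵀ * (1 - (2 / (v ⬝ᵥ v)) • vecMulVec v v) = 1 := by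
  have hsq : vecMulVec v v * vecMulVec v v = (v ⬝ᵥ v) • vecMulVec v v := by
    simp [vecMulVec_mul_vecMulVec]
  simp only [transpose_sub, transpose_one, transpose_smul, transpose_vecMulVec, sub_mul, mul_sub,
    one_mul, mul_one, Matrix.smul_mul, Matrix.mul_smul, hsq, smul_smul]
  ext i j
  simp only [sub_apply, smul_apply, smul_eq_mul]
  field_simp
  ring

/-- If `r` is a unit vector orthogonal to `u`, some orthogonal matrix sends `u` to a vector
whose `i`-th coordinate vanishes. -/
theorem Matrix.exists_orthogonal_mulVec_apply_eq_zero {n F : Type*} [Fintype n] [DecidableEq n]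
    [Field F] (h2 : (2 : F) ≠ 0) {r u : n → F} (hr : r ⬝ᵥ r = 1) (hu : r ⬝ᵥ u = 0) (i : n) :
    ∃ A : Matrix n n F, Aᵀ * A = 1 ∧ (A *ᵥ u) i = 0 := by
  wlog hi : r i ≠ 1 generalizing r
  · refine this (r := -r) (by simpa using hr) (by simpa using hu) fun h => h2 ?_
    rw [not_not] at hi
    rw [Pi.neg_apply, hi] at h
    linear_combination -h
  have hi' : 1 - r i ≠ 0 := sub_ne_zero.mpr hi.symm
  have hv : (Pi.single i 1 - r) ⬝ᵥ (Pi.single i 1 - r) = 2 * (1 - r i) := by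
    simp only [sub_dotProduct, dotProduct_sub, single_one_dotProduct, dotProduct_single_one, hr,
      Pi.sub_apply, Pi.single_eq_same]
    ring
  refine ⟨_, transpose_mul_self_householder (v := Pi.single i 1 - r)
    (hv ▸ mul_ne_zero h2 hi'), ?_⟩
  simp only [hv, sub_mulVec, one_mulVec, smul_mulVec, vecMulVec_mulVec, Pi.sub_apply,
    Pi.smul_apply, sub_dotProduct, single_one_dotProduct, hu, Pi.single_eq_same,
    MulOpposite.smul_eq_mul_unop, MulOpposite.unop_op, smul_eq_mul]
  field_simp
  ring

/-- For an odd prime power `q`, dimension `m ≥ 4`, and `u ∈ F_q^m`,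
there is an orthogonal matrix `A` such that the `m`-th coordinate of `Au` is zero. -/
theorem orthogonal_annihilate_last_coordinate (q m : ℕ) (hq : IsPrimePow q) (hodd : Odd q)
    (hm : 4 ≤ m) (F : Type) [Field F] [Fintype F] (hcard : Fintype.card F = q)
    (u : Fin m → F) :
    ∃ A : Matrix (Fin m) (Fin m) F, Aᵀ * A = 1 ∧
      A.mulVec u ⟨m - 1, by omega⟩ = 0 := by
  have hF : Fintype.card F % 2 = 1 := by rw [hcard]; exact Nat.odd_iff.mp hodd
  have h2 : (2 : F) ≠ 0 := Ring.two_ne_zero fun h => by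
    have := FiniteField.even_card_iff_char_two.mp h
    omega
  obtain ⟨r, hr, hu⟩ := FiniteField.exists_unit_orthogonal hF h2 hm u
  exact exists_orthogonal_mulVec_apply_eq_zero h2 hr hu _
end

section
/- Let q be an odd prime power and u,v ∈ F_q³ with u ≠ 0, v ≠ 0, ⟨u,u⟩ = 0, ⟨u,v⟩ = 0, and such that v is not a scalar multiple of u (i.e. F_q·u ≠ F_q·v). Then ⟨v,v⟩ is a square in F_q if q ≡ 1 (mod 4), and ⟨v,v⟩ is a non-square in F_q (in particular ⟨v,v⟩ ≠ 0) if q ≡ 3 (mod 4). -/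
open Finset

open scoped Matrix

/-- A vector of `F³` whose cross product with `u ≠ 0` vanishes is a multiple of `u`. -/
theorem exists_eq_smul_of_crossProduct_eq_zero {F : Type*} [Field F] {u w : Fin 3 → F}
    (hu : u ≠ 0) (h : u ⨯₃ w = 0) : ∃ c : F, w = c • u := by
  by_contra! hne
  refine crossProduct_ne_zero_iff_linearIndependent.mpr ?_ h
  exact (LinearIndependent.pair_iff' hu).mpr fun c => (hne c).symm

/-- In the orthogonal complement of a nonzero isotropic vector `u` of `F³`, every vector which is
not a multiple of `u` has norm minus a nonzero square. -/
theorem exists_dotProduct_self_eq_neg_sq {F : Type*} [Field F] {u v : Fin 3 → F} (hu : u ≠ 0)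
    (huu : u ⬝ᵥ u = 0) (huv : u ⬝ᵥ v = 0) (hspan : ∀ c : F, v ≠ c • u) :
    ∃ l : F, l ≠ 0 ∧ v ⬝ᵥ v = -l ^ 2 := by
  have huw : u ⨯₃ (u ⨯₃ v) = 0 := by
    rw [cross_cross_eq_smul_sub_smul', huu, huv, zero_smul, zero_smul, sub_zero]
  obtain ⟨l, hl⟩ := exists_eq_smul_of_crossProduct_eq_zero hu huw
  refine ⟨l, ?_, ?_⟩
  · rintro rfl
    rw [zero_smul] at hl
    obtain ⟨c, hc⟩ := exists_eq_smul_of_crossProduct_eq_zero hu hl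
    exact hspan c hc
  · have hvw : v ⨯₃ (u ⨯₃ v) = (v ⬝ᵥ v) • u := by
      rw [cross_cross_eq_smul_sub_smul', huv, zero_smul, sub_zero]
    rw [hl, map_smul, ← cross_anticomm, hl, smul_neg, smul_smul, ← neg_smul] at hvw
    rw [← smul_left_injective F hu hvw, sq]

/-- If `u,v ∈ F_q³` are nonzero with `⟨u,u⟩ = 0`, `⟨u,v⟩ = 0` and `v` not a
scalar multiple of `u`, then `⟨v,v⟩` is a square iff `q ≡ 1 (mod 4)`, and a non-square
if `q ≡ 3 (mod 4)`. -/
theorem isotropic_orthogonal_complement (q : ℕ) (hq : IsPrimePow q) (hodd : Odd q)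
    (F : Type) [Field F] [Fintype F] (hcard : Fintype.card F = q)
    (u v : Fin 3 → F) (hu : u ≠ 0) (hv : v ≠ 0)
    (huu : ∑ i, u i * u i = 0) (huv : ∑ i, u i * v i = 0)
    (hspan : ∀ c : F, v ≠ c • u) :
    (q % 4 = 1 → IsSquare (∑ i, v i * v i)) ∧
    (q % 4 = 3 → ¬ IsSquare (∑ i, v i * v i)) := by
  obtain ⟨l, hl, hvv⟩ := exists_dotProduct_self_eq_neg_sq hu huu huv hspan
  rw [dotProduct] at hvv
  rw [hvv]
  have hneg := FiniteField.isSquare_neg_one_iff (F := F)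
  rw [hcard] at hneg
  constructor
  · intro h
    rw [neg_eq_neg_one_mul]
    exact (hneg.mpr (by omega)).mul (IsSquare.sq l)
  · intro h hsq
    refine hneg.mp ?_ h
    have := hsq.div (IsSquare.sq l)
    rwa [neg_div, div_self (pow_ne_zero 2 hl)] at this
end

section
/- Let q be an odd prime power. The number of vectors u ∈ F_q³ \ {0} such that u₁² + u₂² + u₃² is a square in F_q equals (q−1)·(q+2)(q+1)/2 if q ≡ 1 (mod 4), and equals (q−1)·(q² + q + 2)/2 if q ≡ 3 (mod 4). -/
open Finset

section QuadraticCharSums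

variable {F : Type*} [Field F] [Fintype F] [DecidableEq F]

theorem sum_comp_sq (hF : ringChar F ≠ 2) (f : F → ℤ) :
    ∑ z, f (z ^ 2) = ∑ t, (1 + quadraticChar F t) * f t := by
  rw [← Finset.sum_fiberwise' univ (fun z : F ↦ z ^ 2) f]
  refine Finset.sum_congr rfl fun t _ ↦ ?_
  have h := quadraticChar_card_sqrts hF t
  rw [Finset.sum_const, nsmul_eq_mul, add_comm, ← h]
  congr 3
  ext z
  simp

theorem sum_quadraticChar_mul_add (hF : ringChar F ≠ 2) {a : F} (ha : a ≠ 0) :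
    ∑ t, quadraticChar F t * quadraticChar F (t + a) = -1 := by
  have hJ := jacobiSum_nontrivial_inv (quadraticChar_ne_one hF)
  rw [(quadraticChar_isQuadratic F).inv, jacobiSum] at hJ
  have hm : quadraticChar F (-1) ^ 2 = 1 := quadraticChar_sq_one (neg_ne_zero.2 one_ne_zero)
  have ha2 : quadraticChar F a ^ 2 = 1 := quadraticChar_sq_one ha
  rw [← Equiv.sum_comp (Equiv.mulLeft₀ (-a) (neg_ne_zero.2 ha))]
  have h (x : F) : quadraticChar F (-a * x) * quadraticChar F (-a * x + a) =
      quadraticChar F (-1) * (quadraticChar F x * quadraticChar F (1 - x)) := by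
    rw [show -a * x + a = a * (1 - x) by ring, show -a * x = -1 * (a * x) by ring]
    simp only [map_mul]
    linear_combination
      quadraticChar F (-1) * quadraticChar F x * quadraticChar F (1 - x) * ha2
  refine (Finset.sum_congr rfl fun x _ ↦ h x).trans ?_
  rw [← Finset.mul_sum, hJ]
  linear_combination -hm

theorem sum_quadraticChar_sq_add (hF : ringChar F ≠ 2) (a : F) :
    ∑ z, quadraticChar F (z ^ 2 + a) =
      (Fintype.card F : ℤ) * (if a = 0 then 1 else 0) - 1 := by
  split_ifs with ha
  · subst ha
    have h (z : F) : quadraticChar F (z ^ 2 + 0) = 1 - if z = 0 then 1 else 0 := by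
      split_ifs with hz
      · simp [hz]
      · rw [add_zero, quadraticChar_sq_one' hz, sub_zero]
    simp only [h, Finset.sum_sub_distrib]
    simp
  · rw [sum_comp_sq hF fun t ↦ quadraticChar F (t + a)]
    simp only [add_mul, one_mul, Finset.sum_add_distrib]
    have h := Equiv.sum_comp (Equiv.addRight a) (quadraticChar F)
    simp only [Equiv.coe_addRight, quadraticChar_sum_zero hF] at h
    rw [sum_quadraticChar_mul_add hF ha, h]
    simp

theorem sum_ite_sq_add_eq_zero (hF : ringChar F ≠ 2) (a : F) :
    ∑ z : F, (if z ^ 2 + a = 0 then (1 : ℤ) else 0) =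
      1 + quadraticChar F (-1) * quadraticChar F a := by
  rw [sum_comp_sq hF fun t ↦ if t + a = 0 then (1 : ℤ) else 0, ← map_mul]
  simp [add_eq_zero_iff_eq_neg]

theorem sum_ite_add_sq_eq_zero (hF : ringChar F ≠ 2) :
    ∑ x : F, ∑ y : F, (if y ^ 2 + x ^ 2 = 0 then (1 : ℤ) else 0) =
      Fintype.card F + quadraticChar F (-1) * (Fintype.card F - 1) := by
  have h := sum_quadraticChar_sq_add hF (0 : F)
  simp only [add_zero, if_true, mul_one] at h
  simp only [sum_ite_sq_add_eq_zero hF, Finset.sum_add_distrib, ← Finset.mul_sum, h]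
  simp

theorem sum_quadraticChar_three_sq (hF : ringChar F ≠ 2) :
    ∑ x : F, ∑ y : F, ∑ z : F, quadraticChar F (z ^ 2 + (y ^ 2 + x ^ 2)) =
      quadraticChar F (-1) * Fintype.card F * (Fintype.card F - 1) := by
  simp only [sum_quadraticChar_sq_add hF, Finset.sum_sub_distrib, ← Finset.mul_sum,
    sum_ite_add_sq_eq_zero hF]
  simp
  ring

theorem sum_ite_three_sq_eq_zero (hF : ringChar F ≠ 2) :
    ∑ x : F, ∑ y : F, ∑ z : F, (if z ^ 2 + (y ^ 2 + x ^ 2) = 0 then (1 : ℤ) else 0) =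
      Fintype.card F ^ 2 := by
  simp only [sum_ite_sq_add_eq_zero hF, Finset.sum_add_distrib, ← Finset.mul_sum,
    sum_quadraticChar_sq_add hF]
  simp
  ring

theorem two_mul_ite_isSquare (s : F) [Decidable (IsSquare s)] :
    2 * (if IsSquare s then (1 : ℤ) else 0) =
      1 + quadraticChar F s + if s = 0 then 1 else 0 := by
  by_cases h0 : s = 0
  · simp [h0]
  by_cases hs : IsSquare s
  · simp [h0, hs, (quadraticChar_one_iff_isSquare h0).2 hs]
  · simp [h0, hs, quadraticChar_neg_one_iff_not_isSquare.2 hs]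

open Classical in
theorem two_mul_card_isSquare_three_sq (hF : ringChar F ≠ 2) :
    2 * (Nat.card {u : Fin 3 → F // IsSquare (∑ i, u i ^ 2)} : ℤ) =
      Fintype.card F ^ 3 + quadraticChar F (-1) * Fintype.card F * (Fintype.card F - 1) +
        Fintype.card F ^ 2 := by
  have h : (Nat.card {u : Fin 3 → F // IsSquare (∑ i, u i ^ 2)} : ℤ) =
      ∑ x : F, ∑ y : F, ∑ z : F,
        if IsSquare (z ^ 2 + (y ^ 2 + x ^ 2)) then (1 : ℤ) else 0 := by
    rw [Nat.card_eq_fintype_card, Fintype.card_subtype, Finset.card_filter]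
    push_cast
    rw [← (Fin.consEquiv fun _ : Fin 3 ↦ F).sum_comp, Fintype.sum_prod_type]
    refine Finset.sum_congr rfl fun x _ ↦ ?_
    rw [← (finTwoArrowEquiv F).symm.sum_comp, Fintype.sum_prod_type]
    refine Finset.sum_congr rfl fun y _ ↦ Finset.sum_congr rfl fun z _ ↦ ?_
    have hs : ∑ i, (Fin.consEquiv fun _ : Fin 3 ↦ F)
        (x, (finTwoArrowEquiv F).symm (y, z)) i ^ 2 = z ^ 2 + (y ^ 2 + x ^ 2) := by
      simp [Fin.sum_univ_succ, Fin.consEquiv]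
      ring
    rw [hs]
  rw [h]
  simp only [Finset.mul_sum, two_mul_ite_isSquare]
  simp only [Finset.sum_add_distrib, sum_quadraticChar_three_sq hF, sum_ite_three_sq_eq_zero hF]
  simp
  ring

end QuadraticCharSums

theorem card_ne_and_add_one {α : Type*} [Finite α] {p : α → Prop} {a : α} (ha : p a) :
    Nat.card {u // u ≠ a ∧ p u} + 1 = Nat.card {u // p u} := by
  have h := Set.ncard_sdiff_singleton_add_one (s := {u | p u}) (a := a) ha (Set.toFinite _)
  rw [← Nat.card_coe_set_eq, ← Nat.card_coe_set_eq] at h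
  rw [← Set.coe_ofPred p, ← h]
  congr 1
  exact Nat.card_congr (Equiv.subtypeEquivRight fun u ↦ by simp [and_comm])

/-- The degree of the graph of integral distances in dimension 3:
the number of nonzero `u ∈ F_q³` with `u₁² + u₂² + u₃²` a square equals
`(q−1)(q+2)(q+1)/2` if `q ≡ 1 (mod 4)` and `(q−1)(q²+q+2)/2` if `q ≡ 3 (mod 4)`. -/
theorem degree_dim_three (q : ℕ) (hq : IsPrimePow q) (hodd : Odd q)
    (F : Type) [Field F] [Fintype F] (hcard : Fintype.card F = q) :
    (q % 4 = 1 →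
      Nat.card {u : Fin 3 → F // u ≠ 0 ∧ IsSquare (∑ i, (u i) ^ 2)} =
        (q - 1) * ((q + 2) * (q + 1)) / 2) ∧
    (q % 4 = 3 →
      Nat.card {u : Fin 3 → F // u ≠ 0 ∧ IsSquare (∑ i, (u i) ^ 2)} =
        (q - 1) * (q ^ 2 + q + 2) / 2) := by
  classical
  have hF : ringChar F ≠ 2 := fun h ↦ by
    have := FiniteField.even_card_of_char_two h
    rw [hcard] at this
    exact Nat.not_even_iff_odd.2 hodd (Nat.even_iff.2 this)
  have h0 := card_ne_and_add_one (p := fun u : Fin 3 → F ↦ IsSquare (∑ i, u i ^ 2)) (a := 0)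
    (by simp)
  have h2 := two_mul_card_isSquare_three_sq hF
  rw [← h0, hcard] at h2
  have hq1 : 1 ≤ q := hq.one_lt.le
  have hm : (-1 : F) ≠ 0 := neg_ne_zero.2 one_ne_zero
  have hsq : IsSquare (-1 : F) ↔ q % 4 ≠ 3 := hcard ▸ FiniteField.isSquare_neg_one_iff
  refine ⟨fun h ↦ ?_, fun h ↦ ?_⟩ <;> symm <;>
    refine Nat.div_eq_of_eq_mul_right two_pos ?_ <;> zify [hq1]
  · rw [(quadraticChar_one_iff_isSquare hm).2 (hsq.2 (by lia))] at h2
    push_cast at h2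
    linear_combination -h2
  · rw [quadraticChar_neg_one_iff_not_isSquare.2 fun h' ↦ hsq.1 h' h] at h2
    push_cast at h2
    linear_combination -h2
end

section
/- Let q be an odd prime power and m ≥ 1, and let S(m,q) = |{u ∈ F_q^m : ∑_{i=1}^m u_i² is a nonzero square in F_q}|. If q ≡ 1 (mod 4) then S(m,q) = (q^m − q^{m−1} + q^{(m+1)/2} − q^{(m−1)/2})/2 for m odd and S(m,q) = (q^m − q^{m−1} − q^{m/2} + q^{(m−2)/2})/2 for m even. If q ≡ 3 (mod 4) then S(m,q) = (q^m − q^{m−1} − (−q)^{(m+1)/2} − (−q)^{(m−1)/2})/2 for m odd and S(m,q) = (q^m − q^{m−1} − (−q)^{m/2} − (−q)^{(m−2)/2})/2 for m even. -/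
open Finset

section SumsOfSquares

variable {F : Type*} [Field F] [Fintype F] [DecidableEq F]

theorem sum_comp_sq_eq_sum_quadraticChar (hF : ringChar F ≠ 2) (h : F → ℤ) :
    ∑ x : F, h (x ^ 2) = ∑ b : F, (quadraticChar F b + 1) * h b := by
  rw [← Finset.sum_fiberwise (s := Finset.univ) (g := fun x : F ↦ x ^ 2)]
  refine Finset.sum_congr rfl fun b _ ↦ ?_
  rw [← quadraticChar_card_sqrts hF b, Set.toFinset_ofPred]
  rw [Finset.sum_congr rfl (g := fun _ ↦ h b) fun x hx ↦ by rw [(Finset.mem_filter.mp hx).2]]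
  simp

theorem sum_quadraticChar_sq :
    ∑ c : F, quadraticChar F c ^ 2 = Fintype.card F - 1 := by
  have h (c : F) : quadraticChar F c ^ 2 = 1 - if c = 0 then 1 else 0 := by
    split_ifs with hc
    · simp [hc]
    · rw [quadraticChar_sq_one hc, sub_zero]
  simp only [h, Finset.sum_sub_distrib]
  simp

theorem sum_quadraticChar_mul_quadraticChar_sub (hF : ringChar F ≠ 2) (b : F) :
    ∑ c : F, quadraticChar F c * quadraticChar F (b - c) =
      quadraticChar F (-1) * ((if b = 0 then (Fintype.card F : ℤ) else 0) - 1) := by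
  split_ifs with hb
  · subst hb
    rw [← sum_quadraticChar_sq, Finset.mul_sum]
    refine Finset.sum_congr rfl fun c _ ↦ ?_
    rw [zero_sub, ← neg_one_mul c, map_mul]
    ring
  · have hJ := jacobiSum_nontrivial_inv (quadraticChar_ne_one hF)
    rw [(quadraticChar_isQuadratic F).inv, jacobiSum] at hJ
    rw [← Equiv.sum_comp (Equiv.mulLeft₀ b hb)]
    have h (c : F) : quadraticChar F (b * c) * quadraticChar F (b - b * c) =
        quadraticChar F c * quadraticChar F (1 - c) := by
      rw [← mul_one_sub, map_mul, map_mul]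
      linear_combination quadraticChar F c * quadraticChar F (1 - c) * quadraticChar_sq_one hb
    simp only [Equiv.mulLeft₀_apply, h, hJ]
    ring

theorem sum_comp_sq_add_sq (hF : ringChar F ≠ 2) (h : F → ℤ) :
    ∑ x : F, ∑ y : F, h (x ^ 2 + y ^ 2) =
      (Fintype.card F - quadraticChar F (-1)) * ∑ b, h b +
        quadraticChar F (-1) * Fintype.card F * h 0 := by
  have hshift (c : F) : ∑ x : F, h (c + x ^ 2) =
      ∑ b : F, (quadraticChar F (b - c) + 1) * h b := by
    rw [sum_comp_sq_eq_sum_quadraticChar hF (fun z ↦ h (c + z)),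
      ← Equiv.sum_comp (Equiv.addLeft c) (fun b ↦ (quadraticChar F (b - c) + 1) * h b)]
    simp
  have hinner (b : F) : ∑ x : F, (quadraticChar F (b - x ^ 2) + 1) =
      Fintype.card F +
        quadraticChar F (-1) * ((if b = 0 then (Fintype.card F : ℤ) else 0) - 1) := by
    have hzero : ∑ c : F, quadraticChar F (b - c) = 0 := by
      rw [← quadraticChar_sum_zero hF]
      exact (Equiv.subLeft b).sum_comp (quadraticChar F)
    rw [Finset.sum_add_distrib,
      sum_comp_sq_eq_sum_quadraticChar hF (fun z ↦ quadraticChar F (b - z))]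
    simp only [add_mul, one_mul, Finset.sum_add_distrib, hzero,
      sum_quadraticChar_mul_quadraticChar_sub hF]
    simp
    ring
  simp only [hshift]
  rw [Finset.sum_comm]
  simp only [← Finset.sum_mul, hinner]
  have hterm (b : F) : (Fintype.card F +
      quadraticChar F (-1) * ((if b = 0 then (Fintype.card F : ℤ) else 0) - 1)) * h b =
      (Fintype.card F - quadraticChar F (-1)) * h b +
        if b = 0 then quadraticChar F (-1) * Fintype.card F * h b else 0 := by
    split_ifs <;> ring
  simp only [hterm, Finset.sum_add_distrib, ← Finset.mul_sum, Finset.sum_ite_eq',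
    Finset.mem_univ, if_true]

theorem sum_pi_fin_comp_sum_sq_add_two (hF : ringChar F ≠ 2) (h : F → ℤ) (m : ℕ) :
    ∑ u : Fin (m + 2) → F, h (∑ i, u i ^ 2) =
      (Fintype.card F - quadraticChar F (-1)) * Fintype.card F ^ m * ∑ b, h b +
        quadraticChar F (-1) * Fintype.card F * ∑ u : Fin m → F, h (∑ i, u i ^ 2) := by
  have hcons (n : ℕ) (f : (Fin (n + 1) → F) → ℤ) :
      ∑ u, f u = ∑ v : Fin n → F, ∑ x : F, f (Fin.cons x v) := by
    rw [← (Fin.consEquiv fun _ : Fin (n + 1) ↦ F).sum_comp, Fintype.sum_prod_type_right]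
    rfl
  have htwo (v : Fin m → F) :
      ∑ x : F, ∑ y : F, h (y ^ 2 + (x ^ 2 + ∑ i, v i ^ 2)) =
        (Fintype.card F - quadraticChar F (-1)) * ∑ b, h b +
          quadraticChar F (-1) * Fintype.card F * h (∑ i, v i ^ 2) := by
    have := sum_comp_sq_add_sq hF (fun z ↦ h (z + ∑ i, v i ^ 2))
    have hshift : ∑ b, h (b + ∑ i, v i ^ 2) = ∑ b, h b :=
      Equiv.sum_comp (Equiv.addRight (∑ i, v i ^ 2)) h
    rw [hshift, zero_add, Finset.sum_comm] at this
    simpa only [add_assoc] using this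
  rw [hcons, hcons]
  simp only [Fin.sum_univ_succ, Fin.cons_zero, Fin.cons_succ, htwo, Finset.sum_add_distrib,
    ← Finset.mul_sum]
  simp
  ring

theorem two_mul_ite_isSquare_and_ne_zero (a : F) :
    2 * (if IsSquare a ∧ a ≠ 0 then 1 else 0 : ℤ) = quadraticChar F a ^ 2 + quadraticChar F a := by
  by_cases ha : a = 0
  · simp [ha]
  · rw [quadraticChar_sq_one ha]
    by_cases hs : IsSquare a
    · simp [ha, hs, (quadraticChar_one_iff_isSquare ha).mpr hs]
    · simp [hs, quadraticChar_neg_one_iff_not_isSquare.mpr hs]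

theorem two_mul_sum_ite_isSquare_and_ne_zero (hF : ringChar F ≠ 2) :
    2 * ∑ a : F, (if IsSquare a ∧ a ≠ 0 then 1 else 0 : ℤ) = Fintype.card F - 1 := by
  rw [Finset.mul_sum]
  simp only [two_mul_ite_isSquare_and_ne_zero]
  rw [Finset.sum_add_distrib, sum_quadraticChar_sq, quadraticChar_sum_zero hF, add_zero]

theorem natCard_sum_sq_isSquare_eq_sum (m : ℕ) :
    (Nat.card {u : Fin m → F // IsSquare (∑ i, u i ^ 2) ∧ ∑ i, u i ^ 2 ≠ 0} : ℤ) =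
      ∑ u : Fin m → F, if IsSquare (∑ i, u i ^ 2) ∧ ∑ i, u i ^ 2 ≠ 0 then 1 else 0 := by
  classical
  rw [Nat.card_eq_fintype_card, Fintype.card_subtype, Finset.sum_boole]

theorem two_mul_natCard_sum_sq_isSquare_add_two (hF : ringChar F ≠ 2) (m : ℕ) :
    2 * (Nat.card {u : Fin (m + 2) → F // IsSquare (∑ i, u i ^ 2) ∧ ∑ i, u i ^ 2 ≠ 0} : ℤ) =
      (Fintype.card F - quadraticChar F (-1)) * Fintype.card F ^ m * (Fintype.card F - 1) +
        quadraticChar F (-1) * Fintype.card F *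
          (2 * Nat.card {u : Fin m → F // IsSquare (∑ i, u i ^ 2) ∧ ∑ i, u i ^ 2 ≠ 0}) := by
  rw [natCard_sum_sq_isSquare_eq_sum, natCard_sum_sq_isSquare_eq_sum,
    sum_pi_fin_comp_sum_sq_add_two hF (fun a ↦ if IsSquare a ∧ a ≠ 0 then 1 else 0),
    ← two_mul_sum_ite_isSquare_and_ne_zero hF]
  ring

theorem two_mul_natCard_sum_sq_isSquare_odd (hF : ringChar F ≠ 2) (k : ℕ) :
    2 * (Nat.card {u : Fin (2 * k + 1) → F // IsSquare (∑ i, u i ^ 2) ∧ ∑ i, u i ^ 2 ≠ 0} : ℤ) =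
      (Fintype.card F - 1) *
        ((Fintype.card F : ℤ) ^ (2 * k) + (quadraticChar F (-1) * Fintype.card F) ^ k) := by
  induction k with
  | zero =>
    have h : Nat.card {u : Fin 1 → F // IsSquare (∑ i, u i ^ 2) ∧ ∑ i, u i ^ 2 ≠ 0} =
        Fintype.card F - 1 := by
      rw [← Fintype.card_units, ← Nat.card_eq_fintype_card]
      refine Nat.card_congr (((Equiv.funUnique (Fin 1) F).subtypeEquiv fun u ↦ ?_).trans
        unitsEquivNeZero.symm)
      simp [IsSquare.sq]
    rw [mul_zero, zero_add, h, Nat.cast_sub Fintype.card_pos]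
    simp
    ring
  | succ k ih =>
    rw [show 2 * (k + 1) + 1 = 2 * k + 1 + 2 by ring,
      two_mul_natCard_sum_sq_isSquare_add_two hF, ih]
    ring

theorem two_mul_natCard_sum_sq_isSquare_even (hF : ringChar F ≠ 2) (k : ℕ) :
    2 * (Nat.card {u : Fin (2 * k + 2) → F // IsSquare (∑ i, u i ^ 2) ∧ ∑ i, u i ^ 2 ≠ 0} : ℤ) =
      (Fintype.card F - 1) * ((Fintype.card F : ℤ) ^ (2 * k + 1) -
        quadraticChar F (-1) * (quadraticChar F (-1) * Fintype.card F) ^ k) := by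
  induction k with
  | zero =>
    rw [mul_zero, two_mul_natCard_sum_sq_isSquare_add_two hF]
    simp
    ring
  | succ k ih =>
    rw [show 2 * (k + 1) + 2 = 2 * k + 2 + 2 by ring,
      two_mul_natCard_sum_sq_isSquare_add_two hF, ih]
    ring

end SumsOfSquares

/-- The number `S(m,q)` of vectors `u ∈ F_q^m` such that `∑ u_i²` is a
nonzero square in `F_q`. -/
theorem count_nonzero_square_norm_vectors (q m : ℕ) (hq : IsPrimePow q) (hodd : Odd q)
    (hm : 1 ≤ m) (F : Type) [Field F] [Fintype F] (hcard : Fintype.card F = q) :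
    (q % 4 = 1 →
      (Odd m → (Nat.card {u : Fin m → F //
          IsSquare (∑ i, (u i) ^ 2) ∧ (∑ i, (u i) ^ 2) ≠ 0} : ℚ) =
        ((q : ℚ) ^ m - (q : ℚ) ^ (m - 1) + (q : ℚ) ^ ((m + 1) / 2)
          - (q : ℚ) ^ ((m - 1) / 2)) / 2) ∧
      (Even m → (Nat.card {u : Fin m → F //
          IsSquare (∑ i, (u i) ^ 2) ∧ (∑ i, (u i) ^ 2) ≠ 0} : ℚ) =
        ((q : ℚ) ^ m - (q : ℚ) ^ (m - 1) - (q : ℚ) ^ (m / 2)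
          + (q : ℚ) ^ ((m - 2) / 2)) / 2)) ∧
    (q % 4 = 3 →
      (Odd m → (Nat.card {u : Fin m → F //
          IsSquare (∑ i, (u i) ^ 2) ∧ (∑ i, (u i) ^ 2) ≠ 0} : ℚ) =
        ((q : ℚ) ^ m - (q : ℚ) ^ (m - 1) - (-(q : ℚ)) ^ ((m + 1) / 2)
          - (-(q : ℚ)) ^ ((m - 1) / 2)) / 2) ∧
      (Even m → (Nat.card {u : Fin m → F //
          IsSquare (∑ i, (u i) ^ 2) ∧ (∑ i, (u i) ^ 2) ≠ 0} : ℚ) =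
        ((q : ℚ) ^ m - (q : ℚ) ^ (m - 1) - (-(q : ℚ)) ^ (m / 2)
          - (-(q : ℚ)) ^ ((m - 2) / 2)) / 2)) := by
  classical
  have hF : ringChar F ≠ 2 := fun h ↦ by
    have := FiniteField.even_card_of_char_two h
    rw [hcard] at this
    exact absurd (Nat.odd_iff.mp hodd) (by omega)
  have hneg := quadraticChar_neg_one hF
  rw [hcard] at hneg
  refine ⟨fun hq4 ↦ ?_, fun hq4 ↦ ?_⟩
  · rw [ZMod.χ₄_nat_one_mod_four hq4] at hneg
    refine ⟨?_, fun hme ↦ ?_⟩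
    · rintro ⟨k, rfl⟩
      have h := congrArg (Int.cast : ℤ → ℚ) (two_mul_natCard_sum_sq_isSquare_odd hF k)
      rw [hneg, hcard] at h
      push_cast at h
      rw [show (2 * k + 1 + 1) / 2 = k + 1 by omega, show (2 * k + 1 - 1) / 2 = k by omega,
        Nat.add_sub_cancel]
      linear_combination h / 2
    · obtain ⟨k, rfl⟩ : ∃ k, m = 2 * k + 2 := by
        obtain ⟨j, rfl⟩ := hme
        exact ⟨j - 1, by omega⟩
      have h := congrArg (Int.cast : ℤ → ℚ) (two_mul_natCard_sum_sq_isSquare_even hF k)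
      rw [hneg, hcard] at h
      push_cast at h
      rw [show (2 * k + 2) / 2 = k + 1 by omega, show (2 * k + 2 - 2) / 2 = k by omega,
        show 2 * k + 2 - 1 = 2 * k + 1 by omega]
      linear_combination h / 2
  · rw [ZMod.χ₄_nat_three_mod_four hq4] at hneg
    refine ⟨?_, fun hme ↦ ?_⟩
    · rintro ⟨k, rfl⟩
      have h := congrArg (Int.cast : ℤ → ℚ) (two_mul_natCard_sum_sq_isSquare_odd hF k)
      rw [hneg, hcard, neg_one_mul] at h
      push_cast at h
      rw [show (2 * k + 1 + 1) / 2 = k + 1 by omega, show (2 * k + 1 - 1) / 2 = k by omega,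
        Nat.add_sub_cancel]
      linear_combination h / 2
    · obtain ⟨k, rfl⟩ : ∃ k, m = 2 * k + 2 := by
        obtain ⟨j, rfl⟩ := hme
        exact ⟨j - 1, by omega⟩
      have h := congrArg (Int.cast : ℤ → ℚ) (two_mul_natCard_sum_sq_isSquare_even hF k)
      rw [hneg, hcard, neg_one_mul] at h
      push_cast at h
      rw [show (2 * k + 2) / 2 = k + 1 by omega, show (2 * k + 2 - 2) / 2 = k by omega,
        show 2 * k + 2 - 1 = 2 * k + 1 by omega]
      linear_combination h / 2
end

section
/- Let q be an odd prime power and m ≥ 3 odd. Then the graph of integral distances G_{m,q} is not strongly regular: there exist no parameters k, λ, μ such that G_{m,q} is a strongly regular graph with q^m vertices, degree k, λ common neighbors for every pair of adjacent vertices, and μ common neighbors for every pair of distinct non-adjacent vertices. -/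
open Finset SimpleGraph

section StronglyRegular

variable {V : Type*} [Fintype V] [DecidableEq V] {G : SimpleGraph V} [DecidableRel G.Adj]

/-- An eigenvalue of a strongly regular graph with an eigenvector of coordinate sum zero is
a root of a fixed quadratic polynomial. -/
theorem SimpleGraph.IsSRGWith.eigenvalue_sq {R : Type*} [CommRing R] [IsDomain R]
    {n k l μ : ℕ} (h : G.IsSRGWith n k l μ) {x : V → R} {θ : R} (hx : x ≠ 0)
    (hsum : ∑ v, x v = 0) (hθ : (G.adjMatrix R).mulVec x = θ • x) :
    θ ^ 2 = (k - μ) + (l - μ) * θ := by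
  obtain ⟨v, hv⟩ := Function.ne_iff.mp hx
  have hc : (1 + G.adjMatrix R + Gᶜ.adjMatrix R).mulVec x = 0 := by
    classical
    rw [← compl_adjMatrix_eq_adjMatrix_compl, one_add_adjMatrix_add_compl_adjMatrix_eq_of_one]
    ext w
    simp [Matrix.mulVec, dotProduct, hsum]
  have hs := congrArg (fun M => M.mulVec x) (h.matrix_eq (α := R))
  simp only [pow_two, ← Matrix.mulVec_mulVec, hθ, Matrix.mulVec_smul, Matrix.add_mulVec,
    Matrix.smul_mulVec, Matrix.one_mulVec] at hs hc
  have hs' := congrFun hs v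
  have hc' := congrFun hc v
  simp only [Pi.add_apply, Pi.smul_apply, smul_eq_mul, Pi.zero_apply] at hs' hc'
  simp only [nsmul_eq_mul] at hs'
  refine mul_right_cancel₀ hv ?_
  linear_combination hs' + μ * hc'

end StronglyRegular

theorem quadratic_three_roots_false {R : Type*} [CommRing R] [IsDomain R] {a b x y z : R}
    (hx : x ^ 2 = a + b * x) (hy : y ^ 2 = a + b * y) (hz : z ^ 2 = a + b * z)
    (hxy : x ≠ y) (hxz : x ≠ z) (hyz : y ≠ z) : False := by
  have h1 : x + y = b := mul_left_cancel₀ (sub_ne_zero.mpr hxy) (by linear_combination hx - hy)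
  have h2 : x + z = b := mul_left_cancel₀ (sub_ne_zero.mpr hxz) (by linear_combination hx - hz)
  exact hyz (add_left_cancel (h1.trans h2.symm))

theorem exists_sum_sq_eq {F : Type*} [Field F] [Fintype F]
    (hF : ringChar F ≠ 2) (a : F) : ∃ x y : F, x ^ 2 + y ^ 2 = a := by
  have hdeg : (Polynomial.X ^ 2 - Polynomial.C a : Polynomial F).degree = 2 :=
    Polynomial.degree_X_pow_sub_C (by decide) _
  obtain ⟨x, y, h⟩ := FiniteField.exists_root_sum_quadratic
    (Polynomial.degree_X_pow (R := F) 2) hdeg (FiniteField.odd_card_of_char_ne_two hF)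
  refine ⟨x, y, ?_⟩
  simp only [Polynomial.eval_pow, Polynomial.eval_X, Polynomial.eval_sub, Polynomial.eval_C] at h
  linear_combination h

theorem exists_ne_zero_sum_sq_eq {F : Type*} [Field F] [Fintype F]
    (hF : ringChar F ≠ 2) {m : ℕ} (hm : 3 ≤ m) (a : F) :
    ∃ b : Fin m → F, b ≠ 0 ∧ ∑ i, b i ^ 2 = a := by
  obtain ⟨x, y, h⟩ := exists_sum_sq_eq hF (a - 1)
  obtain ⟨j, rfl⟩ := Nat.exists_eq_add_of_le' hm
  refine ⟨Fin.cons 1 (Fin.cons x (Fin.cons y 0)), fun h0 => ?_, ?_⟩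
  · simpa using congrFun h0 0
  · simp only [Fin.sum_univ_succ, Fin.cons_zero, Fin.cons_succ, Pi.zero_apply]
    simp
    linear_combination h

theorem AddChar.map_finsetSum_eq_prod {A R κ : Type*} [AddCommMonoid A] [CommMonoid R]
    (ψ : AddChar A R) (s : Finset κ) (f : κ → A) : ψ (∑ i ∈ s, f i) = ∏ i ∈ s, ψ (f i) := by
  classical
  induction s using Finset.induction_on with
  | empty => simp
  | insert a s ha ih => rw [sum_insert ha, prod_insert ha, AddChar.map_add_eq_mul, ih]

theorem sum_addChar_sum {F ι : Type*} [Field F] [Fintype F] [Fintype ι] [DecidableEq ι]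
    (ψ : AddChar F ℂ) (f : ι → F → F) :
    ∑ x : ι → F, ψ (∑ i, f i (x i)) = ∏ i, ∑ y, ψ (f i y) := by
  simp_rw [AddChar.map_finsetSum_eq_prod, Fintype.prod_sum]

section GaussSum

variable {F : Type*} [Field F] [Fintype F] [DecidableEq F]

/-- The quadratic character of a finite field, with complex values. -/
noncomputable def complexQuadraticChar (F : Type*) [Field F] [Fintype F] [DecidableEq F] :
    MulChar F ℂ :=
  (quadraticChar F).ringHomComp (Int.castRingHom ℂ)

theorem complexQuadraticChar_apply (a : F) :
    complexQuadraticChar F a = (quadraticChar F a : ℂ) := rfl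

@[simp]
theorem complexQuadraticChar_zero : complexQuadraticChar F 0 = 0 :=
  MulChar.map_nonunit _ not_isUnit_zero

theorem complexQuadraticChar_sq {a : F} (ha : a ≠ 0) : complexQuadraticChar F a ^ 2 = 1 := by
  rw [complexQuadraticChar_apply]
  exact_mod_cast quadraticChar_sq_one ha

theorem complexQuadraticChar_inv (a : F) :
    complexQuadraticChar F a⁻¹ = complexQuadraticChar F a := by
  rcases eq_or_ne a 0 with rfl | ha
  · simp
  · have h : complexQuadraticChar F a⁻¹ * complexQuadraticChar F a = 1 := by
      rw [← map_mul, inv_mul_cancel₀ ha, map_one]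
    linear_combination complexQuadraticChar F a * h -
      complexQuadraticChar F a⁻¹ * complexQuadraticChar_sq ha

theorem complexQuadraticChar_pow_odd {n : ℕ} (hn : Odd n) (a : F) :
    complexQuadraticChar F a ^ n = complexQuadraticChar F a := by
  rcases eq_or_ne a 0 with rfl | ha
  · simp [hn.pos.ne']
  · obtain ⟨j, rfl⟩ := hn
    rw [pow_succ, pow_mul, complexQuadraticChar_sq ha, one_pow, one_mul]

theorem complexQuadraticChar_ne_one (hF : ringChar F ≠ 2) : complexQuadraticChar F ≠ 1 := by
  obtain ⟨a, ha⟩ := quadraticChar_exists_neg_one' hF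
  intro h
  have h1 := congrArg (fun χ : MulChar F ℂ => χ a) h
  simp only [complexQuadraticChar_apply, ha, MulChar.one_apply_coe] at h1
  norm_num at h1

theorem sum_apply_sq_eq (hF : ringChar F ≠ 2) (f : F → ℂ) :
    ∑ y, f (y ^ 2) = ∑ s, (1 + complexQuadraticChar F s) * f s := by
  rw [← Finset.sum_fiberwise_of_maps_to (s := univ) (t := univ) (g := fun y : F => y ^ 2)
    (fun _ _ => mem_univ _)]
  refine Finset.sum_congr rfl fun s _ => ?_
  rw [Finset.sum_congr rfl (g := fun _ => f s) (fun y hy => by rw [(mem_filter.mp hy).2])]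
  have h := quadraticChar_card_sqrts hF s
  rw [Set.toFinset_ofPred] at h
  rw [Finset.sum_const, nsmul_eq_mul, complexQuadraticChar_apply]
  congr 1
  rw [← Int.cast_natCast, h]
  push_cast
  ring

variable {ψ : AddChar F ℂ}

theorem gaussSum_complexQuadraticChar_ne_zero (hF : ringChar F ≠ 2) (hψ : ψ.IsPrimitive) :
    gaussSum (complexQuadraticChar F) ψ ≠ 0 :=
  gaussSum_ne_zero_of_nontrivial (Nat.cast_ne_zero.mpr Fintype.card_ne_zero)
    (complexQuadraticChar_ne_one hF) hψ

theorem sum_complexQuadraticChar_mul (hF : ringChar F ≠ 2) (ψ : AddChar F ℂ) (a : F) :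
    ∑ s, complexQuadraticChar F s * ψ (a * s) =
      complexQuadraticChar F a * gaussSum (complexQuadraticChar F) ψ := by
  rcases eq_or_ne a 0 with rfl | ha
  · simpa using MulChar.sum_eq_zero_of_ne_one (complexQuadraticChar_ne_one hF)
  · have h := gaussSum_mulShift (complexQuadraticChar F) ψ (Units.mk0 a ha)
    rw [← h, ← mul_assoc, Units.val_mk0, ← pow_two, complexQuadraticChar_sq ha, one_mul]
    rfl

theorem sum_addChar_mul_sq (hF : ringChar F ≠ 2) (hψ : ψ.IsPrimitive) {t : F} (ht : t ≠ 0) :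
    ∑ y, ψ (t * y ^ 2) =
      complexQuadraticChar F t * gaussSum (complexQuadraticChar F) ψ := by
  rw [sum_apply_sq_eq hF (fun s => ψ (t * s)), ← sum_complexQuadraticChar_mul hF]
  simp_rw [add_mul, one_mul, Finset.sum_add_distrib, mul_comm t]
  rw [AddChar.sum_mulShift t hψ, if_neg ht, Nat.cast_zero, zero_add]

theorem sum_addChar_quadratic (hF : ringChar F ≠ 2) (hψ : ψ.IsPrimitive) {t : F} (ht : t ≠ 0)
    (b : F) :
    ∑ y, ψ (t * y ^ 2 + b * y) = complexQuadraticChar F t *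
      gaussSum (complexQuadraticChar F) ψ * ψ (-(4 * t)⁻¹ * b ^ 2) := by
  have h2 : (2 : F) ≠ 0 := Ring.two_ne_zero hF
  rw [← sum_addChar_mul_sq hF hψ ht, Finset.sum_mul,
    ← Equiv.sum_comp (Equiv.addRight (b / (2 * t))) (fun y => ψ (t * y ^ 2) * _)]
  refine Finset.sum_congr rfl fun y _ => ?_
  rw [← AddChar.map_add_eq_mul]
  congr 1
  simp only [Equiv.coe_addRight]
  have h42 : (4 : F) = 2 * 2 := by norm_num
  rw [h42]
  field_simp
  ring

end GaussSum

section SquareDistance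

variable {F : Type*} [Field F] [Fintype F] [DecidableEq F] {ψ : AddChar F ℂ}
  {ι : Type*} [Fintype ι] [DecidableEq ι]

theorem sum_addChar_linear (hψ : ψ.IsPrimitive) {b : ι → F} (hb : b ≠ 0) :
    ∑ x : ι → F, ψ (∑ i, b i * x i) = 0 := by
  obtain ⟨i, hi⟩ := Function.ne_iff.mp hb
  rw [sum_addChar_sum ψ (fun i y => b i * y)]
  refine Finset.prod_eq_zero (mem_univ i) ?_
  simp_rw [mul_comm (b i)]
  rw [AddChar.sum_mulShift _ hψ, if_neg (by simpa using hi), Nat.cast_zero]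

theorem sum_addChar_sq_add_linear (hF : ringChar F ≠ 2) (hψ : ψ.IsPrimitive)
    (hι : Odd (Fintype.card ι)) {b : ι → F} (hb : b ≠ 0) (t : F) :
    ∑ x : ι → F, ψ (t * ∑ i, x i ^ 2 + ∑ i, b i * x i) =
      complexQuadraticChar F t * gaussSum (complexQuadraticChar F) ψ ^ Fintype.card ι *
        ψ (-(4 * t)⁻¹ * ∑ i, b i ^ 2) := by
  rcases eq_or_ne t 0 with rfl | ht
  · simpa using sum_addChar_linear hψ hb
  · simp_rw [Finset.mul_sum, ← Finset.sum_add_distrib]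
    rw [sum_addChar_sum ψ (fun i y => t * y ^ 2 + b i * y)]
    simp_rw [sum_addChar_quadratic hF hψ ht]
    rw [Finset.prod_mul_distrib, AddChar.map_finsetSum_eq_prod, Finset.prod_const, mul_pow,
      Finset.card_univ, complexQuadraticChar_pow_odd hι]

theorem sum_addChar_detect_isSquare (hF : ringChar F ≠ 2) (hψ : ψ.IsPrimitive) (s : F)
    [Decidable (IsSquare s)] :
    ∑ t, (1 + ∑ y, ψ (-t * y ^ 2)) * ψ (t * s) =
      2 * Fintype.card F * if IsSquare s then 1 else 0 := by
  have h1 (y : F) : ∑ t, ψ (-t * y ^ 2) * ψ (t * s) =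
      if s - y ^ 2 = 0 then (Fintype.card F : ℂ) else 0 := by
    rw [← Nat.cast_zero (R := ℂ), ← apply_ite Nat.cast, ← AddChar.sum_mulShift _ hψ]
    refine Finset.sum_congr rfl fun t _ => ?_
    rw [← AddChar.map_add_eq_mul]
    congr 1
    ring
  simp_rw [add_mul, one_mul, Finset.sum_add_distrib, Finset.sum_mul]
  rw [Finset.sum_comm]
  simp_rw [h1]
  rw [AddChar.sum_mulShift _ hψ, sum_apply_sq_eq hF (fun z => if s - z = 0 then _ else _)]
  simp_rw [sub_eq_zero]
  rw [Fintype.sum_eq_single s (fun x hx => by rw [if_neg hx.symm, mul_zero]), if_pos rfl,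
    complexQuadraticChar_apply]
  rcases eq_or_ne s 0 with rfl | hs
  · simp
    ring
  · by_cases hq : IsSquare s
    · rw [(quadraticChar_one_iff_isSquare hs).mpr hq]
      simp [hs, hq]
      ring
    · rw [quadraticChar_neg_one_iff_not_isSquare.mpr hq]
      simp [hs, hq]

/-- The Fourier transform, away from the origin, of the set of vectors of square norm. -/
theorem sum_isSquare_addChar (hF : ringChar F ≠ 2) (hψ : ψ.IsPrimitive)
    (hι : Odd (Fintype.card ι)) {b : ι → F} (hb : b ≠ 0) [DecidablePred (IsSquare (α := F))] :
    2 * Fintype.card F *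
        ∑ x : ι → F, (if IsSquare (∑ i, x i ^ 2) then 1 else 0) * ψ (∑ i, b i * x i) =
      complexQuadraticChar F (-1) *
        gaussSum (complexQuadraticChar F) ψ ^ (Fintype.card ι + 1) *
        (complexQuadraticChar F (∑ i, b i ^ 2) +
          (if ∑ i, b i ^ 2 = 0 then (Fintype.card F : ℂ) else 0) - 1) := by
  set g := gaussSum (complexQuadraticChar F) ψ
  set Q := ∑ i, b i ^ 2
  have h2 : (2 : F) ≠ 0 := Ring.two_ne_zero hF
  have h42 : (4 : F) = 2 * 2 := by norm_num
  have e4 : complexQuadraticChar F 4 = 1 := by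
    rw [h42, map_mul, ← pow_two, complexQuadraticChar_sq h2]
  have em : complexQuadraticChar F (-1) ^ 2 = 1 := complexQuadraticChar_sq (by simp)
  have hpt (t : F) : (1 + ∑ y, ψ (-t * y ^ 2)) * complexQuadraticChar F t =
      (1 + complexQuadraticChar F (-1) * complexQuadraticChar F t * g) *
        complexQuadraticChar F t := by
    rcases eq_or_ne t 0 with rfl | ht
    · simp
    · rw [sum_addChar_mul_sq hF hψ (neg_ne_zero.mpr ht), ← map_mul, neg_one_mul]
  let E : F ≃ F := Function.Involutive.toPerm (fun t => -(4 * t)⁻¹) (fun t => by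
    rcases eq_or_ne t 0 with rfl | ht
    · simp
    · rw [h42]
      field_simp)
  have hE (t : F) : complexQuadraticChar F (E t) =
      complexQuadraticChar F (-1) * complexQuadraticChar F t := by
    change complexQuadraticChar F (-(4 * t)⁻¹) = _
    rw [← neg_one_mul, map_mul, complexQuadraticChar_inv, map_mul, e4, one_mul]
  have hEE (t : F) : -(4 * E t)⁻¹ = t := E.left_inv t
  have hsq (t : F) : complexQuadraticChar F t ^ 2 = 1 - if t = 0 then 1 else 0 := by
    rcases eq_or_ne t 0 with rfl | ht
    · simp
    · simp [complexQuadraticChar_sq ht, ht]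
  calc
    _ = ∑ x : ι → F, ∑ t, (1 + ∑ y, ψ (-t * y ^ 2)) *
          ψ (t * ∑ i, x i ^ 2 + ∑ i, b i * x i) := by
        rw [Finset.mul_sum]
        refine Finset.sum_congr rfl fun x _ => ?_
        rw [← mul_assoc, ← sum_addChar_detect_isSquare hF hψ, Finset.sum_mul]
        simp_rw [AddChar.map_add_eq_mul, mul_assoc]
    _ = ∑ t, (1 + complexQuadraticChar F (-1) * complexQuadraticChar F t * g) *
          complexQuadraticChar F t * g ^ Fintype.card ι * ψ (-(4 * t)⁻¹ * Q) := by
        rw [Finset.sum_comm]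
        refine Finset.sum_congr rfl fun t _ => ?_
        rw [← Finset.mul_sum, sum_addChar_sq_add_linear hF hψ hι hb, ← hpt]
        ring
    _ = ∑ t, complexQuadraticChar F (-1) * g ^ Fintype.card ι *
          (complexQuadraticChar F t * ψ (Q * t) + g * ψ (t * Q) -
            g * (if t = 0 then ψ (t * Q) else 0)) := by
        rw [← Equiv.sum_comp E]
        refine Finset.sum_congr rfl fun t _ => ?_
        rw [hE, hEE, mul_comm Q]
        have h := hsq t
        split_ifs at h ⊢ <;>
          linear_combination complexQuadraticChar F (-1) * g ^ Fintype.card ι * g * ψ (t * Q) *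
            (complexQuadraticChar F t ^ 2 * em + h)
    _ = _ := by
        rw [← Finset.mul_sum, Finset.sum_sub_distrib, Finset.sum_add_distrib,
          sum_complexQuadraticChar_mul hF, ← Finset.mul_sum, ← Finset.mul_sum,
          AddChar.sum_mulShift _ hψ]
        simp only [sum_ite_eq', mem_univ, if_true, zero_mul, AddChar.map_zero_eq_one]
        push_cast
        ring

end SquareDistance

section IntegralDistances

variable {F : Type*} [Field F] [Fintype F] [DecidableEq F] {ι : Type*} [Fintype ι] [DecidableEq ι]

theorem adjMatrix_mulVec_addChar (ψ : AddChar F ℂ) (b : ι → F)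
    [DecidablePred (IsSquare (α := F))]
    [DecidableRel (SimpleGraph.fromRel
        (fun u v : ι → F => IsSquare (∑ i, (u i - v i) ^ 2))).Adj] :
    ((SimpleGraph.fromRel
        (fun u v : ι → F => IsSquare (∑ i, (u i - v i) ^ 2))).adjMatrix ℂ).mulVec
        (fun v => ψ (∑ i, b i * v i)) =
      (∑ x : ι → F, (if IsSquare (∑ i, x i ^ 2) then 1 else 0) * ψ (∑ i, b i * x i) - 1) •
        (fun v => ψ (∑ i, b i * v i)) := by
  ext v
  have hone (z : ℂ) :
      z - 1 = z - ∑ x : ι → F, (if x = 0 then 1 else 0) * ψ (∑ i, b i * x i) := by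
    rw [Fintype.sum_eq_single 0 (fun x hx => by rw [if_neg hx, zero_mul])]
    simp
  rw [Pi.smul_apply, smul_eq_mul, hone, ← Finset.sum_sub_distrib, Finset.sum_mul,
    Matrix.mulVec, dotProduct, ← Equiv.sum_comp (Equiv.addRight v)]
  refine Finset.sum_congr rfl fun x _ => ?_
  simp only [Equiv.coe_addRight, adjMatrix_apply, fromRel_adj, Pi.add_apply, mul_add,
    Finset.sum_add_distrib, AddChar.map_add_eq_mul, sub_add_cancel_right, add_sub_cancel_right,
    neg_sq, or_self]
  rcases eq_or_ne x 0 with rfl | hx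
  · simp
  · have : v ≠ x + v := fun h => hx (by simpa using h.symm)
    simp only [ne_eq, this, not_false_eq_true, true_and, hx, if_false]
    ring

end IntegralDistances

open scoped Classical in
/-- For an odd prime power `q` and odd `m ≥ 3`, the graph of integral
distances on `F_q^m` (two distinct vertices are adjacent iff the squared distance is
a square) is not strongly regular. -/
theorem graph_of_integral_distances_not_SRG (q m : ℕ) (hq : IsPrimePow q) (hodd : Odd q)
    (hm : 3 ≤ m) (hmodd : Odd m)
    (F : Type) [Field F] [Fintype F] (hcard : Fintype.card F = q) :
    ¬ ∃ k l μ : ℕ,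
      (SimpleGraph.fromRel
        (fun u v : Fin m → F => IsSquare (∑ i, (u i - v i) ^ 2))).IsSRGWith
        (q ^ m) k l μ := by
  rintro ⟨k, l, μ, h⟩
  have hF : ringChar F ≠ 2 := fun h2 => by
    have := FiniteField.even_card_of_char_two h2
    rw [hcard, Nat.odd_iff.mp hodd] at this
    exact one_ne_zero this
  let ψ : AddChar F ℂ := AddChar.FiniteField.primitiveChar_to_Complex F
  have hψ : ψ.IsPrimitive := AddChar.FiniteField.primitiveChar_to_Complex_isPrimitive F
  obtain ⟨ν, hν⟩ := quadraticChar_exists_neg_one hF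
  have hν0 : ν ≠ 0 := by
    rintro rfl
    simp at hν
  have hq0 : (Fintype.card F : ℂ) ≠ 0 := Nat.cast_ne_zero.mpr Fintype.card_ne_zero
  have hq1 : (Fintype.card F : ℂ) ≠ 1 := by
    exact_mod_cast Fintype.one_lt_card.ne'
  have hι : Odd (Fintype.card (Fin m)) := by rwa [Fintype.card_fin]
  obtain ⟨C, hC, hθ⟩ : ∃ C : ℂ, C ≠ 0 ∧ ∀ a : F,
      ∀ θ, θ = C * (complexQuadraticChar F a +
        (if a = 0 then (Fintype.card F : ℂ) else 0) - 1) - 1 →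
      θ ^ 2 = (k - μ) + (l - μ) * θ := by
    refine ⟨complexQuadraticChar F (-1) *
        gaussSum (complexQuadraticChar F) ψ ^ (Fintype.card (Fin m) + 1) /
          (2 * Fintype.card F), ?_, ?_⟩
    · refine div_ne_zero (mul_ne_zero ?_ (pow_ne_zero _
        (gaussSum_complexQuadraticChar_ne_zero hF hψ))) (mul_ne_zero two_ne_zero hq0)
      intro h0
      have := complexQuadraticChar_sq (F := F) (neg_ne_zero.mpr one_ne_zero)
      simp [h0] at this
    · rintro a θ rfl
      obtain ⟨b, hb, rfl⟩ := exists_ne_zero_sum_sq_eq hF hm a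
      rw [div_mul_eq_mul_div, ← sum_isSquare_addChar hF hψ hι hb,
        mul_div_cancel_left₀ _ (mul_ne_zero two_ne_zero hq0)]
      refine h.eigenvalue_sq (fun h0 => ?_) (sum_addChar_linear hψ hb)
        (adjMatrix_mulVec_addChar ψ b)
      simpa using congrFun h0 0
  have h0 := hθ 0 (C * (Fintype.card F - 1) - 1) (by simp)
  have h1 := hθ 1 (-1) (by simp)
  have h2 := hθ ν (C * (-2) - 1) (by
    rw [complexQuadraticChar_apply, hν, if_neg hν0]
    push_cast
    ring)
  refine quadratic_three_roots_false h0 h1 h2 (fun e => ?_) (fun e => ?_) (fun e => ?_)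
  · exact mul_ne_zero hC (sub_ne_zero.mpr hq1) (by linear_combination e)
  · have : (Fintype.card F : ℂ) + 1 ≠ 0 := Nat.cast_add_one_ne_zero _
    exact mul_ne_zero hC this (by linear_combination e)
  · exact mul_ne_zero hC two_ne_zero (by linear_combination e)
end

section
/- Let q be a prime power with q ≡ 1 (mod 4). Then I(3,q) = q²: there exists an integral point set in F_q³ of cardinality q² (namely the hyperplane {(α, ωα, β) : α,β ∈ F_q} where ω ∈ F_q satisfies ω² = −1), and every integral point set in F_q³ has cardinality at most q². -/
open Finset

/-- Translating along a direction of nonsquare norm is injective on an integral point set,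
so such a set has at most `|F|²` points. -/
theorem card_le_sq_of_integral {F : Type*} [Field F] [Fintype F] {v : Fin 3 → F}
    (hv : ¬ IsSquare (∑ i, v i ^ 2)) (P : Finset (Fin 3 → F))
    (hP : ∀ u ∈ P, ∀ w ∈ P, IsSquare (∑ i, (u i - w i) ^ 2)) :
    P.card ≤ Fintype.card F ^ 2 := by
  classical
  have hinj : Function.Injective (fun x : P × F => (x.1 : Fin 3 → F) + x.2 • v) := by
    rintro ⟨⟨u, hu⟩, s⟩ ⟨⟨w, hw⟩, t⟩ h
    have hcoord : ∀ i, u i - w i = (t - s) * v i := fun i => by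
      have := congrFun h i
      simp only [Pi.add_apply, Pi.smul_apply, smul_eq_mul] at this
      linear_combination this
    have hts : t = s := by
      by_contra hne
      have hne' : t - s ≠ 0 := sub_ne_zero.mpr hne
      apply hv
      obtain ⟨r, hr⟩ := hP u hu w hw
      simp only [hcoord, mul_pow, ← Finset.mul_sum] at hr
      refine ⟨r / (t - s), ?_⟩
      field_simp
      linear_combination hr
    subst hts
    have huw : u = w := funext fun i => sub_eq_zero.mp (by simpa using hcoord i)
    subst huw
    rfl
  have hle := Fintype.card_le_of_injective _ hinj
  simp only [Fintype.card_prod, Fintype.card_coe, Fintype.card_fun, Fintype.card_fin] at hle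
  exact Nat.le_of_mul_le_mul_right (by rwa [pow_succ] at hle) (Fintype.card_pos (α := F))

/-- For `ω² = -1`, the plane `{(α, ωα, β)}` is an integral point set with `|F|²` points. -/
theorem exists_integral_card_eq_sq {F : Type*} [Field F] [Fintype F] {ω : F}
    (hω : ω ^ 2 = -1) :
    ∃ P : Finset (Fin 3 → F),
      (∀ u ∈ P, ∀ v ∈ P, IsSquare (∑ i, (u i - v i) ^ 2)) ∧ P.card = Fintype.card F ^ 2 := by
  classical
  refine ⟨univ.image fun x : F × F => ![x.1, ω * x.1, x.2], ?_, ?_⟩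
  · simp only [mem_image, mem_univ, true_and]
    rintro _ ⟨⟨a, b⟩, rfl⟩ _ ⟨⟨c, d⟩, rfl⟩
    refine ⟨b - d, ?_⟩
    simp only [Fin.sum_univ_three, Matrix.cons_val]
    linear_combination (a - c) ^ 2 * hω
  · rw [card_image_of_injective, card_univ, Fintype.card_prod, sq]
    rintro ⟨a, b⟩ ⟨c, d⟩ h
    have h0 := congrFun h 0
    have h2 := congrFun h 2
    simp only [Matrix.cons_val] at h0 h2
    rw [h0, h2]

/-- For a prime power `q ≡ 1 (mod 4)`, `I(3,q) = q²`: there is an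
integral point set in `F_q³` of cardinality `q²` and every integral point set in
`F_q³` has cardinality at most `q²`. -/
theorem integral_point_set_dim_three_one_mod_four (q : ℕ) (hq : IsPrimePow q)
    (h1 : q % 4 = 1) (F : Type) [Field F] [Fintype F] (hcard : Fintype.card F = q) :
    (∃ P : Finset (Fin 3 → F),
      (∀ u ∈ P, ∀ v ∈ P, IsSquare (∑ i, (u i - v i) ^ 2)) ∧ P.card = q ^ 2) ∧
    (∀ P : Finset (Fin 3 → F),
      (∀ u ∈ P, ∀ v ∈ P, IsSquare (∑ i, (u i - v i) ^ 2)) → P.card ≤ q ^ 2) := by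
  subst hcard
  have hchar : ringChar F ≠ 2 := fun h => by
    have := FiniteField.even_card_of_char_two h
    omega
  have h2 : (2 : F) ≠ 0 := Ring.two_ne_zero hchar
  obtain ⟨ω, hω⟩ := FiniteField.isSquare_neg_one_iff.mpr (by omega : Fintype.card F % 4 ≠ 3)
  have hω' : ω ^ 2 = -1 := by rw [sq, hω]
  obtain ⟨n, hn⟩ := FiniteField.exists_nonsquare hchar
  refine ⟨exists_integral_card_eq_sq hω',
    card_le_sq_of_integral (v := ![(n + 1) / 2, ω * (n - 1) / 2, 0]) ?_⟩
  have hsum : ∑ i, (![(n + 1) / 2, ω * (n - 1) / 2, 0] : Fin 3 → F) i ^ 2 = n := by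
    simp only [Fin.sum_univ_three, Matrix.cons_val]
    field_simp
    linear_combination (n - 1) ^ 2 * hω'
  rwa [hsum]
end

section
/- Let q be an odd prime power. Then there exists a subset P ⊆ F_q⁴ of cardinality q² such that every pair of points u,v ∈ P satisfies ∑_{i=1}^4 (u_i − v_i)² = 0; in particular P is an integral point set in F_q⁴ all of whose squared distances are equal to zero. -/
open Finset

/-- In a finite field, `-1` is a sum of two squares. -/
theorem FiniteField.exists_sq_add_sq_eq_neg_one (F : Type*) [Field F] [Finite F] :
    ∃ a b : F, a ^ 2 + b ^ 2 = -1 := by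
  obtain ⟨p, hp⟩ := CharP.exists F
  have : NeZero p := ⟨CharP.char_ne_zero_of_finite F p⟩
  obtain ⟨a, b, h⟩ := CharP.sq_add_sq F p (-1)
  exact ⟨a, b, by simpa using h⟩

/-- For an odd prime power `q`, there is a set `P ⊆ F_q⁴` of cardinality
`q²` all of whose squared distances are equal to zero. -/
theorem exists_isotropic_point_set_dim_four (q : ℕ) (hq : IsPrimePow q) (hodd : Odd q)
    (F : Type) [Field F] [Fintype F] (hcard : Fintype.card F = q) :
    ∃ P : Finset (Fin 4 → F), P.card = q ^ 2 ∧
      ∀ u ∈ P, ∀ v ∈ P, ∑ i, (u i - v i) ^ 2 = 0 := by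
  classical
  obtain ⟨a, b, hab⟩ := FiniteField.exists_sq_add_sq_eq_neg_one F
  let f : F × F → Fin 4 → F := fun z ↦ ![z.1, z.2, a * z.1 + b * z.2, b * z.1 - a * z.2]
  have hf : Function.Injective f := fun z w h ↦
    Prod.ext (by simpa [f] using congrFun h 0) (by simpa [f] using congrFun h 1)
  refine ⟨univ.image f, ?_, ?_⟩
  · rw [card_image_of_injective _ hf, card_univ, Fintype.card_prod, hcard, sq]
  · intro u hu v hv
    obtain ⟨z, -, rfl⟩ := mem_image.mp hu
    obtain ⟨w, -, rfl⟩ := mem_image.mp hv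
    simp only [f, Fin.sum_univ_four, Matrix.cons_val]
    linear_combination ((z.1 - w.1) ^ 2 + (z.2 - w.2) ^ 2) * hab
end

section
/- Let q be an odd prime power and m ≥ 1. If q ≡ 1 (mod 4) then I(m,q) ≥ q^⌈m/2⌉. If q ≡ 3 (mod 4) then I(m,q) ≥ q^⌊m/2⌋. In other words, there exist integral point sets in F_q^m of these cardinalities. -/
open Finset

/-- `F ^ m` contains an integral point set with exactly `n` points. -/
def HasIntegralPointSet (F : Type*) [Field F] (m n : ℕ) : Prop :=
  ∃ P : Finset (Fin m → F),
    (∀ u ∈ P, ∀ v ∈ P, IsSquare (∑ i, (u i - v i) ^ 2)) ∧ P.card = n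

namespace HasIntegralPointSet

variable {F : Type*} [Field F] {m n : ℕ}

theorem zero : HasIntegralPointSet F 0 1 :=
  ⟨{0}, by simp, by simp⟩

theorem one [Fintype F] : HasIntegralPointSet F 1 (Fintype.card F) := by
  classical
  exact ⟨univ, fun u _ v _ => by simp [IsSquare.sq], by simp⟩

/-- An integral point set remains one after an isometric embedding of it, times a space of
parameters on which the squared distance vanishes. -/
theorem of_injective {ι : Type*} [Fintype ι] {k : ℕ} (h : HasIntegralPointSet F m n)
    (f : ι × (Fin m → F) → (Fin k → F)) (hf : Function.Injective f)
    (hdist : ∀ a b, ∑ i, (f a i - f b i) ^ 2 = ∑ i, (a.2 i - b.2 i) ^ 2) :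
    HasIntegralPointSet F k (Fintype.card ι * n) := by
  classical
  obtain ⟨P, hP, rfl⟩ := h
  refine ⟨(univ ×ˢ P).image f, ?_, ?_⟩
  · simp only [mem_image, mem_product, mem_univ, true_and]
    rintro _ ⟨a, ha, rfl⟩ _ ⟨b, hb, rfl⟩
    rw [hdist]
    exact hP _ ha _ hb
  · rw [card_image_of_injective _ hf, card_product, card_univ]

theorem succ (h : HasIntegralPointSet F m n) : HasIntegralPointSet F (m + 1) n := by
  have := h.of_injective (ι := Unit) (k := m + 1) (fun a => Fin.cons 0 a.2)
    (fun a b hab => Prod.ext rfl (Fin.cons_right_injective _ hab))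
    (fun a b => by simp [Fin.sum_univ_succ])
  simpa using this

/-- The line spanned by the isotropic vector `(1, i)` with `i ^ 2 = -1` adds two coordinates. -/
theorem add_two [Fintype F] (h : HasIntegralPointSet F m n) (hF : IsSquare (-1 : F)) :
    HasIntegralPointSet F (m + 2) (Fintype.card F * n) := by
  obtain ⟨i, hi⟩ := hF
  refine h.of_injective (ι := F) (fun a => Fin.cons a.1 (Fin.cons (i * a.1) a.2 : Fin (m + 1) → F))
    ?_ ?_
  · rintro ⟨x, u⟩ ⟨y, v⟩ hab
    simp only [Fin.cons_inj] at hab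
    exact Prod.ext hab.1 hab.2.2
  · rintro ⟨x, u⟩ ⟨y, v⟩
    simp only [Fin.sum_univ_succ, Fin.cons_zero, Fin.cons_succ]
    linear_combination -(x - y) ^ 2 * hi

/-- The totally isotropic plane spanned by `(1, 0, a, b)` and `(0, 1, -b, a)` with
`a ^ 2 + b ^ 2 = -1` adds four coordinates. -/
theorem add_four [Fintype F] (h : HasIntegralPointSet F m n) {a b : F}
    (hab : a ^ 2 + b ^ 2 = -1) :
    HasIntegralPointSet F (m + 4) (Fintype.card F ^ 2 * n) := by
  have := h.of_injective (ι := F × F) (k := m + 4)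
    (fun p => Fin.cons p.1.1 (Fin.cons p.1.2 (Fin.cons (a * p.1.1 - b * p.1.2)
      (Fin.cons (b * p.1.1 + a * p.1.2) p.2 : Fin (m + 1) → F) : Fin (m + 2) → F) :
      Fin (m + 3) → F)) ?_ ?_
  · simpa [sq] using this
  · rintro ⟨⟨x, y⟩, u⟩ ⟨⟨z, w⟩, v⟩ h
    simp only [Fin.cons_inj] at h
    exact Prod.ext (Prod.ext h.1 h.2.1) h.2.2.2.2
  · rintro ⟨⟨x, y⟩, u⟩ ⟨⟨z, w⟩, v⟩
    simp only [Fin.sum_univ_succ, Fin.cons_zero, Fin.cons_succ]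
    linear_combination ((x - z) ^ 2 + (y - w) ^ 2) * hab

theorem pow_ceil_half [Fintype F] (hF : IsSquare (-1 : F)) :
    ∀ m, HasIntegralPointSet F m (Fintype.card F ^ ((m + 1) / 2))
  | 0 => by simpa using zero
  | 1 => by simpa using one
  | m + 2 => by
    have := (pow_ceil_half hF m).add_two hF
    rwa [← pow_succ', show (m + 1) / 2 + 1 = (m + 2 + 1) / 2 by omega] at this

theorem pow_floor_half [Fintype F] {a b : F} (hab : a ^ 2 + b ^ 2 = -1) :
    ∀ m, HasIntegralPointSet F m (Fintype.card F ^ (m / 2))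
  | 0 => by simpa using zero
  | 1 => by simpa using zero.succ
  | 2 => by simpa using one.succ
  | 3 => by simpa using one.succ.succ
  | m + 4 => by
    have := (pow_floor_half hab m).add_four hab
    rwa [← pow_add, show 2 + m / 2 = (m + 4) / 2 by omega] at this

end HasIntegralPointSet

/-- Lower bounds for `I(m,q)`: for `q ≡ 1 (mod 4)` there is an integral
point set in `F_q^m` of cardinality `q^⌈m/2⌉`, and for `q ≡ 3 (mod 4)` there is one of
cardinality `q^⌊m/2⌋`. -/
theorem integral_point_set_lower_bounds (q m : ℕ) (hq : IsPrimePow q) (hodd : Odd q)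
    (hm : 1 ≤ m) (F : Type) [Field F] [Fintype F] (hcard : Fintype.card F = q) :
    (q % 4 = 1 → ∃ P : Finset (Fin m → F),
      (∀ u ∈ P, ∀ v ∈ P, IsSquare (∑ i, (u i - v i) ^ 2)) ∧ P.card = q ^ ((m + 1) / 2)) ∧
    (q % 4 = 3 → ∃ P : Finset (Fin m → F),
      (∀ u ∈ P, ∀ v ∈ P, IsSquare (∑ i, (u i - v i) ^ 2)) ∧ P.card = q ^ (m / 2)) := by
  subst hcard
  refine ⟨fun h => HasIntegralPointSet.pow_ceil_half
    (FiniteField.isSquare_neg_one_iff.2 (by omega)) m, fun _ => ?_⟩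
  obtain ⟨p, _⟩ := CharP.exists F
  have : NeZero p := ⟨CharP.char_ne_zero_of_finite F p⟩
  obtain ⟨a, b, hab⟩ := CharP.sq_add_sq F p (-1)
  exact HasIntegralPointSet.pow_floor_half (by simpa using hab) m
end
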